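/- arXiv:2503.03728 — 2 statements merged into one kernel-verified Lean document; each statement's English description precedes it below -/
import Mathlib

section
/- Let R = k[x_1,…,x_d] and let φ = [Φ₁; Φ₂] be an n×(n−1) matrix with a = d, where Φ₂ is a nonzero (n−d)×(n−1) matrix of linear forms (ε₂ = 1), I = I_{n−1}(φ) has height 2, J ⊆ I is the ideal generated by the d maximal minors of φ fixing the rows of Φ₂, and assume ht I_{n−d}(Φ₂) = d. Then J satisfies condition G_∞ if and only if I satisfies condition G_d. -/
open Matrix MvPolynomial

noncomputable section

def idealHeight {A : Type*} [CommRing A] (I : Ideal A) : ℕ∞ :=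
  ⨅ (P : PrimeSpectrum A) (_ : I ≤ P.asIdeal), Order.height P

def minorsIdeal {A : Type*} [CommRing A] {p q : ℕ} (t : ℕ)
    (M : Matrix (Fin p) (Fin q) A) : Ideal A :=
  Ideal.span { x | ∃ (r : Fin t → Fin p) (c : Fin t → Fin q),
    Function.Injective r ∧ Function.Injective c ∧ x = (M.submatrix r c).det }

/-- Condition `G_s` of Artin–Nagata: for every prime `P ⊇ L` with `ht P ≤ s − 1`,
the localization `L_P` can be generated by at most `ht P` elements. -/
def CondG {A : Type*} [CommRing A] (L : Ideal A) (s : ℕ) : Prop :=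
  ∀ P : Ideal A, P.IsPrime → L ≤ P → idealHeight P + 1 ≤ (s : ℕ∞) →
    ∃ c : ℕ, (c : ℕ∞) ≤ idealHeight P ∧ ∃ g : Fin c → A, (∀ i, g i ∈ L) ∧
      ∀ x ∈ L, ∃ u ∉ P, u * x ∈ Ideal.span (Set.range g)

/-- The skew-symmetric matrix of signed `m × m` minors (obtained by omitting two columns)
of an `m × (m+2)` matrix; this is the middle differential of the Buchsbaum–Rim complex. -/
def bbrim {A : Type*} [CommRing A] {m : ℕ} (ψ : Matrix (Fin m) (Fin (m + 2)) A) :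
    Matrix (Fin (m + 2)) (Fin (m + 2)) A :=
  Matrix.of fun i j =>
    if h : (i : ℕ) < (j : ℕ) then
      (-1) ^ ((i : ℕ) + (j : ℕ)) *
        (ψ.submatrix id (fun q => j.succAbove
          ((⟨(i : ℕ), by have := j.isLt; omega⟩ : Fin (m + 1)).succAbove q))).det
    else if h' : (j : ℕ) < (i : ℕ) then
      (-1) ^ ((i : ℕ) + (j : ℕ) + 1) *
        (ψ.submatrix id (fun q => i.succAbove
          ((⟨(j : ℕ), by have := i.isLt; omega⟩ : Fin (m + 1)).succAbove q))).det
    else 0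

def rowMap {A : Type*} [CommRing A] {ι : Type*} [Fintype ι] (g : ι → A) :
    (ι → A) →ₗ[A] A :=
  ∑ i, g i • LinearMap.proj i

/-- Data of a (necessarily minimal) graded free resolution
`0 → ⊕_j R(−a_j) → ⊕_i R(−b_i) → I → 0` of an ideal of a polynomial ring. -/
def HasResolutionData {A : Type*} [CommRing A] {σ : Type*} (I : Ideal (MvPolynomial σ A))
    {N M : ℕ} (b : Fin N → ℕ) (a : Fin M → ℕ) : Prop :=
  ∃ (g : Fin N → MvPolynomial σ A) (φ : Matrix (Fin N) (Fin M) (MvPolynomial σ A)),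
    (∀ i, (g i).IsHomogeneous (b i)) ∧ Ideal.span (Set.range g) = I ∧
    (∀ i j, (φ i j).IsHomogeneous (a j - b i) ∧ (a j ≤ b i → φ i j = 0)) ∧
    Function.Injective φ.mulVecLin ∧
    LinearMap.range φ.mulVecLin = LinearMap.ker (rowMap g)

/-- The Castelnuovo–Mumford regularity of a codimension-two perfect ideal, read off from
its minimal graded free resolution `0 → ⊕_j R(−a_j) → ⊕_i R(−b_i) → I → 0` as
`max(max_i b_i, max_j a_j − 1)`. -/
def HasRegularity {A : Type*} [CommRing A] {σ : Type*} (I : Ideal (MvPolynomial σ A))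
    (r : ℕ) : Prop :=
  ∃ (N M : ℕ) (b : Fin N → ℕ) (a : Fin M → ℕ), HasResolutionData I b a ∧
    (Finset.univ.sup b) ⊔ ((Finset.univ.sup a) - 1) = r

def IsCohenMacaulayRing (A : Type*) [CommRing A] : Prop :=
  ∀ P : Ideal A, P.IsMaximal → ∃ rs : List A,
    (∀ x ∈ rs, x ∈ P) ∧ RingTheory.Sequence.IsRegular A rs ∧
      (rs.length : ℕ∞) = idealHeight P

def reesPresentation {A : Type*} [CommRing A] {n : ℕ} (f : Fin n → A) :
    MvPolynomial (Fin n) A →ₐ[A] Polynomial A :=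
  MvPolynomial.aeval fun i => Polynomial.C (f i) * Polynomial.X

def Ideal.IsLinearType {A : Type*} [CommRing A] (I : Ideal A) : Prop :=
  ∀ (n : ℕ) (f : Fin n → A), Ideal.span (Set.range f) = I →
    RingHom.ker (reesPresentation f) =
      Ideal.span {p | p ∈ RingHom.ker (reesPresentation f) ∧ p.IsHomogeneous 1}

def moduleDepth {A : Type*} [CommRing A] (J : Ideal A) (M : Type*)
    [AddCommGroup M] [Module A M] : ℕ∞ :=
  sSup {c : ℕ∞ | ∃ rs : List A, (∀ x ∈ rs, x ∈ J) ∧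
    RingTheory.Sequence.IsRegular M rs ∧ (rs.length : ℕ∞) = c}

def analyticSpread {A : Type*} [CommRing A] (m I : Ideal A) : WithBot ℕ∞ :=
  ringKrullDim ((reesAlgebra I) ⧸ (Ideal.map (algebraMap A (reesAlgebra I)) m))

section Points

variable {k : Type*} [Field k]

def gradedPiece (I : Ideal (MvPolynomial (Fin 3) k)) (t : ℕ) :
    Submodule k (MvPolynomial (Fin 3) k) :=
  Submodule.restrictScalars k I ⊓ homogeneousSubmodule (Fin 3) k t

def pointIdeal (p : Fin 3 → k) : Ideal (MvPolynomial (Fin 3) k) :=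
  Ideal.span {f | f.IsHomogeneous 1 ∧ MvPolynomial.eval p f = 0}

def vanishingIdeal {n : ℕ} (pts : Fin n → (Fin 3 → k)) : Ideal (MvPolynomial (Fin 3) k) :=
  ⨅ i, pointIdeal (pts i)

def oneTimesPiece (I : Ideal (MvPolynomial (Fin 3) k)) (s : ℕ) :
    Submodule k (MvPolynomial (Fin 3) k) :=
  Submodule.span k {g | ∃ ℓ f, ℓ ∈ homogeneousSubmodule (Fin 3) k 1 ∧
    f ∈ gradedPiece I s ∧ g = ℓ * f}

def IsPointFamily {n : ℕ} (pts : Fin n → (Fin 3 → k)) : Prop :=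
  (∀ i, pts i ≠ 0) ∧ ∀ i j, i ≠ j → ∀ c : k, pts i ≠ c • pts j

def InGenericPosition {n : ℕ} (pts : Fin n → (Fin 3 → k)) : Prop :=
  ∀ t : ℕ, Module.finrank k (gradedPiece (vanishingIdeal pts) t) = (t + 2).choose 2 - n

def InUniformPosition {n : ℕ} (pts : Fin n → (Fin 3 → k)) : Prop :=
  ∀ T : Finset (Fin n), ∀ t : ℕ,
    Module.finrank k (gradedPiece (⨅ i ∈ T, pointIdeal (pts i)) t) = (t + 2).choose 2 - T.card

def HasInitialDegree (I : Ideal (MvPolynomial (Fin 3) k)) (s : ℕ) : Prop :=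
  gradedPiece I s ≠ ⊥ ∧ ∀ t < s, gradedPiece I t = ⊥

def InTightGenericPosition {n : ℕ} (pts : Fin n → (Fin 3 → k)) (s : ℕ) : Prop :=
  InGenericPosition pts ∧
    Module.finrank k (oneTimesPiece (vanishingIdeal pts) s) =
      min (3 * Module.finrank k (gradedPiece (vanishingIdeal pts) s))
        (Module.finrank k (gradedPiece (vanishingIdeal pts) (s + 1)))

def IsBirationalOntoImage {N : ℕ} (f : Fin N → MvPolynomial (Fin 3) k) : Prop :=
  ∃ (e : ℕ) (G : Fin 3 → MvPolynomial (Fin N) k) (w : MvPolynomial (Fin 3) k),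
    w ≠ 0 ∧ (∀ j, (G j).IsHomogeneous e) ∧
      ∀ j, MvPolynomial.aeval f (G j) = w * MvPolynomial.X j

end Points

end

theorem idealHeight_mono {A : Type*} [CommRing A] {I K : Ideal A} (h : I ≤ K) :
    idealHeight I ≤ idealHeight K :=
  le_iInf₂ fun P hP => iInf₂_le P (h.trans hP)

/-- The signed maximal minor of an `(m+1) × m` matrix obtained by omitting row `i`. -/
def signedMinor {A : Type*} [CommRing A] {m : ℕ} (φ : Matrix (Fin (m + 1)) (Fin m) A)
    (i : Fin (m + 1)) : A :=
  (-1) ^ (i : ℕ) * (φ.submatrix i.succAbove id).det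

theorem signedMinor_vecMul {A : Type*} [CommRing A] {m : ℕ}
    (φ : Matrix (Fin (m + 1)) (Fin m) A) : signedMinor φ ᵥ* φ = 0 := by
  ext j
  let M : Matrix (Fin (m + 1)) (Fin (m + 1)) A :=
    Matrix.of fun i => Fin.cons (φ i j) (φ i)
  have hM : M.det = 0 :=
    Matrix.det_zero_of_column_eq (i := 0) (j := j.succ) (Fin.succ_ne_zero j).symm
      fun i => by simp [M]
  rw [Matrix.det_succ_column_zero] at hM
  rw [Pi.zero_apply, ← hM]
  change ∑ i, signedMinor φ i * φ i j = _
  refine Finset.sum_congr rfl fun i _ => ?_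
  have hsub : M.submatrix i.succAbove Fin.succ = φ.submatrix i.succAbove id := by
    ext a b
    simp [M]
  rw [hsub]
  simp only [signedMinor, M, Matrix.of_apply, Fin.cons_zero]
  ring

theorem signedMinor_mem_minorsIdeal {A : Type*} [CommRing A] {m : ℕ}
    (φ : Matrix (Fin (m + 1)) (Fin m) A) (i : Fin (m + 1)) :
    signedMinor φ i ∈ minorsIdeal m φ :=
  Ideal.mul_mem_left _ _ <| Ideal.subset_span
    ⟨_, _, Fin.succAbove_right_injective, Function.injective_id, rfl⟩

theorem minorsIdeal_le_span_signedMinor {A : Type*} [CommRing A] {m : ℕ}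
    (φ : Matrix (Fin (m + 1)) (Fin m) A) :
    minorsIdeal m φ ≤ Ideal.span (Set.range (signedMinor φ)) := by
  refine Ideal.span_le.2 ?_
  rintro _ ⟨r, c, hr, hc, rfl⟩
  obtain ⟨i, hi⟩ : ∃ i, ∀ q, r q ≠ i := by
    by_contra! h
    have := Fintype.card_le_of_surjective r h
    simp at this
  choose σ hσ using fun q => Fin.exists_succAbove_eq (hi q)
  have hσi : Function.Injective σ := fun a b hab => hr <| by rw [← hσ a, ← hσ b, hab]
  let s := Equiv.ofBijective σ (Finite.injective_iff_bijective.1 hσi)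
  let t := Equiv.ofBijective c (Finite.injective_iff_bijective.1 hc)
  have hdet : (φ.submatrix r c).det =
      Equiv.Perm.sign t * (Equiv.Perm.sign s * (φ.submatrix i.succAbove id).det) := by
    rw [← Matrix.det_permute, ← Matrix.det_permute']
    congr 1
    ext a b
    simp [s, t, hσ]
  have hmem : (φ.submatrix i.succAbove id).det ∈ Ideal.span (Set.range (signedMinor φ)) := by
    have h : (φ.submatrix i.succAbove id).det = (-1) ^ (i : ℕ) * signedMinor φ i := by
      rw [signedMinor, ← mul_assoc, ← mul_pow]
      simp
    rw [h]
    exact Ideal.mul_mem_left _ _ (Ideal.subset_span ⟨i, rfl⟩)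
  rw [hdet]
  exact Ideal.mul_mem_left _ _ (Ideal.mul_mem_left _ _ hmem)

theorem det_mul_mem_of_vecMul_mem {A : Type*} [CommRing A] {n : Type*} [Fintype n]
    [DecidableEq n] {J : Ideal A} (B : Matrix n n A) (v : n → A)
    (h : ∀ j, (v ᵥ* B) j ∈ J) (i : n) : B.det * v i ∈ J := by
  have hv : B.det * v i = ((v ᵥ* B) ᵥ* B.adjugate) i := by
    rw [Matrix.vecMul_vecMul, Matrix.mul_adjugate, Matrix.vecMul_smul, Matrix.vecMul_one]
    rfl
  rw [hv]
  exact J.sum_mem fun j _ => J.mul_mem_right _ (h j)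

/-- A maximal minor of the lower block of rows conducts all maximal minors into the ideal
generated by those omitting one of the first `d` rows. -/
theorem exists_notMem_forall_mul_mem {A : Type*} [CommRing A] {d m : ℕ} (hdm : d ≤ m + 1)
    (φ : Matrix (Fin (m + 1)) (Fin m) A) (Φ₂ : Matrix (Fin (m + 1 - d)) (Fin m) A)
    (hΦ₂ : ∀ i j, Φ₂ i j = φ ⟨d + (i : ℕ), by have := i.isLt; omega⟩ j) {J P : Ideal A}
    (hJ : ∀ i : Fin (m + 1), (i : ℕ) < d → signedMinor φ i ∈ J)
    (hP : ¬ minorsIdeal (m + 1 - d) Φ₂ ≤ P) :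
    ∃ u ∉ P, ∀ x ∈ minorsIdeal m φ, u * x ∈ J := by
  obtain ⟨_, ⟨r, c, hr, -, rfl⟩, hu⟩ := Set.not_subset.1 (mt Ideal.span_le.2 hP)
  refine ⟨_, hu, ?_⟩
  let s := Equiv.ofBijective r (Finite.injective_iff_bijective.1 hr)
  let low : Fin (m + 1 - d) → Fin (m + 1) := fun i => ⟨d + (i : ℕ), by have := i.isLt; omega⟩
  have hsum : ∀ j, ∑ i, signedMinor φ (low i) * Φ₂ i j ∈ J := by
    intro j
    have h0 : ∑ i, signedMinor φ i * φ i j = 0 := congrFun (signedMinor_vecMul φ) j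
    rw [← (finCongr (Nat.add_sub_cancel' hdm)).sum_comp, Fin.sum_univ_add] at h0
    have h1 : ∑ i, signedMinor φ (low i) * Φ₂ i j =
        -∑ i : Fin d, signedMinor φ (finCongr (Nat.add_sub_cancel' hdm) (Fin.castAdd _ i)) *
          φ (finCongr (Nat.add_sub_cancel' hdm) (Fin.castAdd _ i)) j := by
      rw [eq_neg_iff_add_eq_zero, add_comm, ← h0]
      congr 1
      exact Finset.sum_congr rfl fun i _ => by rw [hΦ₂]; rfl
    rw [h1]
    exact J.neg_mem (J.sum_mem fun i _ => J.mul_mem_right _ (hJ _ i.isLt))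
  have hlow : ∀ i, (Φ₂.submatrix r c).det * signedMinor φ (low i) ∈ J := by
    intro i
    have := det_mul_mem_of_vecMul_mem (J := J) (Φ₂.submatrix r c)
      (fun q => signedMinor φ (low (r q))) (fun j => by
        have h := hsum (c j)
        rwa [← s.sum_comp] at h) (s.symm i)
    rwa [show r (s.symm i) = i from s.apply_symm_apply i] at this
  suffices h : minorsIdeal m φ ≤ Submodule.comap (LinearMap.mulLeft A (Φ₂.submatrix r c).det) J from h
  refine (minorsIdeal_le_span_signedMinor φ).trans (Ideal.span_le.2 ?_)
  rintro _ ⟨i, rfl⟩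
  change (Φ₂.submatrix r c).det * signedMinor φ i ∈ J
  by_cases hi : (i : ℕ) < d
  · exact J.mul_mem_left _ (hJ i hi)
  · have := hlow ⟨i - d, by omega⟩
    rwa [show low ⟨i - d, by omega⟩ = i from Fin.ext (Nat.add_sub_cancel' (not_lt.1 hi))] at this

/-- If `J ⊆ I` agree locally at all primes of height less than `d` and `J` has `d` generators,
then `J` satisfies `G_{d+1}` exactly when `I` satisfies `G_d`. -/
theorem condG_succ_iff {A : Type*} [CommRing A] {I J : Ideal A} {d : ℕ} (hJI : J ≤ I)
    (hloc : ∀ P : Ideal A, P.IsPrime → idealHeight P + 1 ≤ d → ∃ u ∉ P, ∀ x ∈ I, u * x ∈ J)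
    (f : Fin d → A) (hf : Ideal.span (Set.range f) = J) :
    CondG J (d + 1) ↔ CondG I d := by
  constructor
  · intro h P hP hIP hht
    obtain ⟨u, hu, huI⟩ := hloc P hP hht
    obtain ⟨c, hc, g, hg, hx⟩ := h P hP (hJI.trans hIP)
      (hht.trans (by exact_mod_cast Nat.le_succ d))
    refine ⟨c, hc, g, fun i => hJI (hg i), fun x hxI => ?_⟩
    obtain ⟨w, hw, hwx⟩ := hx _ (huI x hxI)
    exact ⟨w * u, hP.mul_notMem hw hu, by rwa [mul_assoc]⟩
  · intro h P hP hJP hht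
    by_cases hdP : (d : ℕ∞) ≤ idealHeight P
    · exact ⟨d, hdP, f, fun i => hf ▸ Ideal.subset_span ⟨i, rfl⟩,
        fun x hx => ⟨1, P.one_notMem, by rwa [hf, one_mul]⟩⟩
    have hht' : idealHeight P + 1 ≤ d := Order.add_one_le_of_lt (not_le.1 hdP)
    obtain ⟨u, hu, huI⟩ := hloc P hP hht'
    have hIP : I ≤ P := fun x hx => (hP.mem_or_mem (hJP (huI x hx))).resolve_left hu
    obtain ⟨c, hc, g, hg, hx⟩ := h P hP hIP hht'
    refine ⟨c, hc, fun i => u * g i, fun i => huI _ (hg i), fun x hxJ => ?_⟩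
    obtain ⟨w, hw, hwx⟩ := hx x (hJI hxJ)
    refine ⟨u * w, hP.mul_notMem hu hw, ?_⟩
    rw [mul_assoc]
    suffices hs : Ideal.span (Set.range g) ≤
        Submodule.comap (LinearMap.mulLeft A u) (Ideal.span (Set.range fun i => u * g i)) from hs hwx
    refine Ideal.span_le.2 ?_
    rintro _ ⟨i, rfl⟩
    exact Ideal.subset_span ⟨i, rfl⟩

/-- Let `R = k[x_1,…,x_d]` and let `φ = [Φ₁; Φ₂]` be an `n×(n−1)` matrix
with `a = d`, where `Φ₂` is a nonzero `(n−d)×(n−1)` matrix of linear forms, the entries of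
`Φ₁` are forms of degree `ε₁`, `I = I_{n−1}(φ)` has height 2, `J ⊆ I` is the ideal generated
by the `d` maximal minors of `φ` fixing the rows of `Φ₂`, and `ht I_{n−d}(Φ₂) = d`.
Then `J` satisfies `G_∞` if and only if `I` satisfies `G_d`.  (Here `n = m + 1`.) -/
theorem statement0 {k : Type*} [Field k] [Infinite k] {d m : ℕ}
    (hd : 1 ≤ d) (hdm : d ≤ m) (ε₁ : ℕ) (hε₁ : 1 ≤ ε₁)
    (φ : Matrix (Fin (m + 1)) (Fin m) (MvPolynomial (Fin d) k))
    (Φ₁ : Matrix (Fin d) (Fin m) (MvPolynomial (Fin d) k))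
    (Φ₂ : Matrix (Fin (m + 1 - d)) (Fin m) (MvPolynomial (Fin d) k))
    (hΦ₁ : Φ₁ = φ.submatrix (fun i : Fin d => (⟨(i : ℕ), by have := i.isLt; omega⟩ : Fin (m + 1))) id)
    (hΦ₂ : Φ₂ = φ.submatrix (fun i : Fin (m + 1 - d) => (⟨d + (i : ℕ), by have := i.isLt; omega⟩ : Fin (m + 1))) id)
    (hdeg₁ : ∀ i j, (Φ₁ i j).IsHomogeneous ε₁)
    (hdeg₂ : ∀ i j, (Φ₂ i j).IsHomogeneous 1)
    (hne : Φ₂ ≠ 0)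
    (hI : idealHeight (minorsIdeal m φ) = 2)
    (hht : idealHeight (minorsIdeal (m + 1 - d) Φ₂) = (d : ℕ∞))
    (J : Ideal (MvPolynomial (Fin d) k))
    (hJ : J = Ideal.span (Set.range fun i : Fin d =>
      (-1) ^ (i : ℕ) *
        (φ.submatrix (Fin.succAbove (⟨(i : ℕ), by have := i.isLt; omega⟩ : Fin (m + 1))) id).det)) :
    CondG J (d + 1) ↔ CondG (minorsIdeal m φ) d := by
  subst hJ
  refine condG_succ_iff ?_ (fun P hP hPd => ?_) _ rfl
  · refine Ideal.span_le.2 ?_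
    rintro _ ⟨i, rfl⟩
    exact signedMinor_mem_minorsIdeal φ _
  · refine exists_notMem_forall_mul_mem (by omega) φ Φ₂ (fun i j => by rw [hΦ₂]; rfl)
      (fun i hi => Ideal.subset_span ⟨⟨i, hi⟩, rfl⟩) fun hle => ?_
    have hd' := (hht ▸ idealHeight_mono hle : (d : ℕ∞) ≤ idealHeight P)
    have := (add_le_add_left hd' 1).trans hPd
    exact absurd (by exact_mod_cast this) (Nat.not_succ_le_self d)
end

section
/- Let R = k[x_1,…,x_d] and let φ = [Φ₁; Φ₂] be an n×(n−1) matrix of linear forms (ε₁ = ε₂ = 1) with a = d, where Φ₂ is a nonzero (n−d)×(n−1) block, I = I_{n−1}(φ) has height 2, J ⊆ I is the ideal generated by the d maximal minors of φ fixing the rows of Φ₂, and assume ht I_{n−d}(Φ₂) = d. Then J is a reduction of I; that is, there exists an integer N ≥ 0 such that I^{N+1} = J·I^N. -/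
open Matrix MvPolynomial

namespace Matrix

/-- A matrix over a field all of whose maximal minors (using all rows) vanish has a
nontrivial left kernel. -/
lemma exists_vecMul_eq_zero_of_minors_eq_zero {K : Type*} [Field K] {d m : ℕ}
    (B : Matrix (Fin d) (Fin m) K)
    (h : ∀ c : Fin d → Fin m, (B.submatrix id c).det = 0) :
    ∃ x : Fin d → K, x ≠ 0 ∧ x ᵥ* B = 0 := by
  by_contra! hx
  have hinj : LinearIndependent K B.row := by
    rw [← Matrix.vecMul_injective_iff, ← Matrix.coe_vecMulLinear,
      injective_iff_map_eq_zero]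
    intro x hxB
    by_contra hx0
    exact hx x hx0 hxB
  have hrank : Module.finrank K (Submodule.span K (Set.range B.col)) = d := by
    rw [← Matrix.rank_eq_finrank_span_cols, hinj.rank_matrix, Fintype.card_fin]
  obtain ⟨f, hf, -, hli⟩ := Submodule.exists_fun_fin_finrank_span_eq K (Set.range B.col)
  choose c hc using hf
  let e := finCongr hrank.symm
  refine (?_ : (B.submatrix id (c ∘ e)).det ≠ 0) (h _)
  have hcol : LinearIndependent K (B.submatrix id (c ∘ e)).col := by
    have hfe : (B.submatrix id (c ∘ e)).col = f ∘ e := by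
      funext i
      rw [Function.comp_apply, ← hc]
      rfl
    rw [hfe]
    exact hli.comp e e.injective
  exact ((Matrix.isUnit_iff_isUnit_det _).1
    (Matrix.linearIndependent_cols_iff_isUnit.1 hcol)).ne_zero

/-- Cofactor expansion: the signed maximal minors of an `(m+1) × m` matrix are a syzygy
of its rows. -/
lemma signed_minors_vecMul {R : Type*} [CommRing R] {m : ℕ}
    (φ : Matrix (Fin (m + 1)) (Fin m) R) (j : Fin m) :
    ∑ i : Fin (m + 1), (-1) ^ (i : ℕ) * (φ.submatrix i.succAbove id).det * φ i j = 0 := by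
  let M : Matrix (Fin (m + 1)) (Fin (m + 1)) R := Matrix.of fun i => Fin.cons (φ i j) (φ i)
  have h0 : M.det = 0 :=
    Matrix.det_zero_of_column_eq (Fin.succ_ne_zero j).symm fun i => by simp [M]
  rw [Matrix.det_succ_column_zero] at h0
  rw [← h0]
  refine Finset.sum_congr rfl fun i _ => ?_
  have : M.submatrix i.succAbove Fin.succ = φ.submatrix i.succAbove id := by
    ext a b
    simp [M]
  rw [this]
  simp only [M, Matrix.of_apply, Fin.cons_zero]
  ring

end Matrix

/-- The ideal of maximal minors of an `(m+1) × m` matrix is generated by the `m + 1` signed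
minors obtained by deleting one row. -/
lemma minorsIdeal_eq_span_signed_minors {R : Type*} [CommRing R] {m : ℕ}
    (φ : Matrix (Fin (m + 1)) (Fin m) R) :
    minorsIdeal m φ = Ideal.span (Set.range fun i : Fin (m + 1) =>
      (-1) ^ (i : ℕ) * (φ.submatrix i.succAbove id).det) := by
  apply le_antisymm
  · refine Ideal.span_le.2 ?_
    rintro _ ⟨r, c, hr, hc, rfl⟩
    have hns : ¬ Function.Surjective r := fun hs => by
      simpa using Fintype.card_le_of_surjective r hs
    obtain ⟨i, hi⟩ := not_forall.1 hns
    have hi' : ∀ a, r a ≠ i := fun a ha => hi ⟨a, ha⟩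
    choose s hs using fun a => Fin.exists_succAbove_eq (hi' a)
    have hsinj : Function.Injective s := fun a b hab => hr (by rw [← hs a, ← hs b, hab])
    let σ := Equiv.ofBijective s (Finite.injective_iff_bijective.1 hsinj)
    let τ := Equiv.ofBijective c (Finite.injective_iff_bijective.1 hc)
    have hrc : φ.submatrix r c = ((φ.submatrix i.succAbove id).submatrix id τ).submatrix σ id := by
      ext a b
      simp [σ, τ, hs]
    rw [hrc, Matrix.det_permute, Matrix.det_permute']
    refine Ideal.mul_mem_left _ _ (Ideal.mul_mem_left _ _ ?_)
    have hmem : (-1) ^ (i : ℕ) * (φ.submatrix i.succAbove id).det ∈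
        Ideal.span (Set.range fun i : Fin (m + 1) =>
          (-1 : R) ^ (i : ℕ) * (φ.submatrix i.succAbove id).det) :=
      Ideal.subset_span ⟨i, rfl⟩
    have := Ideal.mul_mem_left _ ((-1) ^ (i : ℕ)) hmem
    rwa [← mul_assoc, ← mul_pow, neg_one_mul, neg_neg, one_pow, one_mul] at this
  · refine Ideal.span_le.2 ?_
    rintro _ ⟨i, rfl⟩
    exact Ideal.mul_mem_left _ _ (Ideal.subset_span
      ⟨_, _, Fin.succAbove_right_injective, Function.injective_id, rfl⟩)

section Reduction

variable {k R : Type*} [Field k] [CommRing R] [Algebra k R] {ι δ : Type*}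

/-- The `k`-algebra map `k[T_i] → R[t]`, `T_i ↦ f_i t`. -/
noncomputable def fiberMap (k : Type*) [Field k] [Algebra k R] (f : ι → R) :
    MvPolynomial ι k →ₐ[k] Polynomial R :=
  MvPolynomial.aeval fun i => Polynomial.C (f i) * Polynomial.X

@[simp]
lemma fiberMap_X (f : ι → R) (i : ι) :
    fiberMap k f (X i) = Polynomial.C (f i) * Polynomial.X := by
  simp [fiberMap]

lemma coeff_fiberMap_mem (f : ι → R) (g : MvPolynomial ι k) (N : ℕ) :
    (fiberMap k f g).coeff N ∈ Ideal.span (Set.range f) ^ N := by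
  have : fiberMap k f g ∈ reesAlgebra (Ideal.span (Set.range f)) := by
    induction g using MvPolynomial.induction_on with
    | C a =>
      rw [← MvPolynomial.algebraMap_eq, AlgHom.commutes, IsScalarTower.algebraMap_apply k R]
      exact Subalgebra.algebraMap_mem _ _
    | add p q hp hq => rw [map_add]; exact add_mem hp hq
    | mul_X p i hp =>
      rw [map_mul, fiberMap_X]
      have hfi : f i ∈ Ideal.span (Set.range f) ^ 1 := by
        rw [pow_one]
        exact Ideal.subset_span ⟨i, rfl⟩
      rw [Polynomial.C_mul_X_eq_monomial]
      exact mul_mem hp (reesAlgebra.monomial_mem.2 hfi)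
  exact this N

/-- If the variables are nilpotent modulo the relations of the `f_i t` and a subset of the
variables, then the corresponding `f_i` generate a reduction. -/
lemma exists_pow_succ_eq_mul_pow [Finite ι] [Fintype δ] (f : ι → R) (e : δ → ι)
    (h : ∀ i, (X i : MvPolynomial ι k) ∈
      (RingHom.ker (fiberMap k f) ⊔ Ideal.span (Set.range fun j => X (e j))).radical) :
    ∃ N : ℕ, Ideal.span (Set.range f) ^ (N + 1) =
      Ideal.span (Set.range (f ∘ e)) * Ideal.span (Set.range f) ^ N := by
  set L := RingHom.ker (fiberMap k f) ⊔ Ideal.span (Set.range fun j => X (e j)) with hL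
  have hcoeff : ∀ g ∈ L, ∀ N : ℕ, (fiberMap k f g).coeff (N + 1) ∈
      Ideal.span (Set.range (f ∘ e)) * Ideal.span (Set.range f) ^ N := by
    intro g hg N
    obtain ⟨a, ha, b, hb, rfl⟩ := Submodule.mem_sup.1 hg
    obtain ⟨c, rfl⟩ := (Submodule.mem_span_range_iff_exists_fun _).1 hb
    rw [map_add, (RingHom.mem_ker).1 ha, zero_add, map_sum, Polynomial.finsetSum_coeff]
    refine Ideal.sum_mem _ fun j _ => ?_
    rw [smul_eq_mul, map_mul, fiberMap_X, ← mul_assoc, Polynomial.coeff_mul_X,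
      Polynomial.coeff_mul_C]
    exact Ideal.mul_mem_mul_rev (Ideal.subset_span ⟨j, rfl⟩) (coeff_fiberMap_mem f _ _)
  have hfg : (Ideal.span (Set.range (X : ι → MvPolynomial ι k))).FG :=
    Submodule.fg_span (Set.finite_range _)
  have hle : Ideal.span (Set.range (X : ι → MvPolynomial ι k)) ≤ L.radical := by
    refine Ideal.span_le.2 ?_
    rintro _ ⟨i, rfl⟩
    exact h i
  obtain ⟨N, hN⟩ := Ideal.exists_pow_le_of_le_radical_of_fg hle hfg
  refine ⟨N, le_antisymm ?_ ?_⟩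
  · rw [Ideal.span, Submodule.span_pow]
    refine Submodule.span_le.2 fun x hx => ?_
    obtain ⟨s, hs, rfl⟩ := Set.mem_pow_iff_prod.1 hx
    choose j hj using hs
    have hmon : ∏ i, (X (j i) : MvPolynomial ι k) ∈ L := by
      have hmem : ∏ i, (X (j i) : MvPolynomial ι k) ∈
          ∏ _i : Fin (N + 1), Ideal.span (Set.range (X : ι → MvPolynomial ι k)) :=
        Ideal.prod_mem_prod fun i _ => Ideal.subset_span ⟨j i, rfl⟩
      rw [Finset.prod_const, Finset.card_univ, Fintype.card_fin] at hmem
      exact hN (Ideal.pow_le_pow_right N.le_succ hmem)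
    have hval : fiberMap k f (∏ i, X (j i)) =
        Polynomial.C (∏ i, s i) * Polynomial.X ^ (N + 1) := by
      simp only [map_prod, fiberMap_X, hj, Finset.prod_mul_distrib, Finset.prod_const,
        Finset.card_univ, Fintype.card_fin]
    have := hcoeff _ hmon N
    rwa [hval, Polynomial.coeff_C_mul_X_pow, if_pos rfl] at this
  · rw [pow_succ']
    refine Ideal.mul_mono_left (Ideal.span_mono ?_)
    rintro _ ⟨j, rfl⟩
    exact ⟨e j, rfl⟩

end Reduction

lemma MvPolynomial.IsHomogeneous.exists_eq_sum_C_mul_X {k σ : Type*} [CommSemiring k] [Fintype σ]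
    {p : MvPolynomial σ k} (hp : p.IsHomogeneous 1) :
    ∃ a : σ → k, p = ∑ l, C (a l) * X l := by
  have : p ∈ homogeneousSubmodule σ k 1 := hp
  rw [homogeneousSubmodule_one_eq_span_X] at this
  obtain ⟨a, rfl⟩ := (Submodule.mem_span_range_iff_exists_fun _).1 this
  exact ⟨a, by simp [MvPolynomial.smul_eq_C_mul]⟩

/-- If an ideal of `k[x_1,…,x_d]` has height at least `d`, it does not vanish along a line
`κ·x` through the origin with `x ≠ 0`. -/
lemma eq_zero_of_vanish_on_line {k κ : Type*} [Field k] [Field κ] [Algebra k κ] {d : ℕ}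
    (M : Ideal (MvPolynomial (Fin d) k)) (hM : (d : ℕ∞) ≤ idealHeight M) (x : Fin d → κ)
    (hx : ∀ g ∈ M, aeval (fun l => Polynomial.C (x l) * Polynomial.X) g =
      (0 : Polynomial κ)) : x = 0 := by
  by_contra hx0
  obtain ⟨l, hl⟩ := Function.ne_iff.1 hx0
  let ev : MvPolynomial (Fin d) k →ₐ[k] Polynomial κ :=
    aeval (fun l => Polynomial.C (x l) * Polynomial.X)
  let ev0 : MvPolynomial (Fin d) k →ₐ[k] k := aeval 0
  let Q : PrimeSpectrum (MvPolynomial (Fin d) k) := ⟨RingHom.ker ev, RingHom.ker_isPrime _⟩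
  let P : PrimeSpectrum (MvPolynomial (Fin d) k) := ⟨RingHom.ker ev0, RingHom.ker_isPrime _⟩
  have hev : ∀ g, (ev g).coeff 0 = algebraMap k κ (ev0 g) := by
    intro g
    induction g using MvPolynomial.induction_on with
    | C a => simp [ev, ev0, IsScalarTower.algebraMap_apply k κ (Polynomial κ)]
    | add p q hp hq => simp [hp, hq]
    | mul_X p i hp => simp [Polynomial.mul_coeff_zero, ev, ev0]
  have hQP : Q < P := by
    refine lt_of_le_of_ne (fun g hg => ?_) fun h => ?_
    · have h1 := hev g
      rw [show ev g = 0 from hg, Polynomial.coeff_zero] at h1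
      exact (map_eq_zero (algebraMap k κ)).1 h1.symm
    · have h1 : (X l : MvPolynomial (Fin d) k) ∈ P.asIdeal := by
        change ev0 (X l) = 0
        simp [ev0]
      rw [← h] at h1
      have h2 : ev (X l) = 0 := h1
      simp [ev] at h2
      exact hl h2
  have h1 : (d : ℕ∞) ≤ Order.height Q := hM.trans (iInf₂_le Q fun g hg => hx g hg)
  have h2 : Order.height Q + 1 ≤ Order.height P := Order.height_add_one_le hQP
  have h3 : (Order.height P : WithBot ℕ∞) ≤ ((d : ℕ∞) : WithBot ℕ∞) := by
    have := Order.height_le_krullDim P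
    refine this.trans (le_of_eq ?_)
    change ringKrullDim (MvPolynomial (Fin d) k) = _
    rw [MvPolynomial.ringKrullDim_of_isNoetherianRing]
    simp
  have h4 : (d : ℕ∞) + 1 ≤ d := (add_le_add_left h1 1).trans (h2.trans (WithBot.coe_le_coe.1 h3))
  have h5 : d + 1 ≤ d := by exact_mod_cast h4
  omega


/-- Jacobian-dual argument: a point of the special fiber of the ideal of maximal minors of the
linear matrix `φ` whose first `d` coordinates vanish is zero, provided the maximal minors of
the remaining rows have height at least `d`. -/
lemma fiber_point_eq_zero {k κ : Type*} [Field k] [Field κ] [Algebra k κ] {d m : ℕ}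
    (hd : 1 ≤ d) (hdm : d ≤ m)
    (φ : Matrix (Fin (m + 1)) (Fin m) (MvPolynomial (Fin d) k))
    (hlin : ∀ i j, (φ i j).IsHomogeneous 1)
    (Φ₂ : Matrix (Fin (m + 1 - d)) (Fin m) (MvPolynomial (Fin d) k))
    (hΦ₂ : ∀ (i : Fin (m + 1 - d)) (i' : Fin (m + 1)), (i' : ℕ) = d + i → Φ₂ i = φ i')
    (hht : (d : ℕ∞) ≤ idealHeight (minorsIdeal (m + 1 - d) Φ₂))
    (θ : MvPolynomial (Fin (m + 1)) k →ₐ[k] κ)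
    (hker : ∀ g, fiberMap k (fun i : Fin (m + 1) =>
      (-1) ^ (i : ℕ) * (φ.submatrix i.succAbove id).det) g = 0 → θ g = 0)
    (hzero : ∀ i : Fin (m + 1), (i : ℕ) < d → θ (X i) = 0) (i₀ : Fin (m + 1)) :
    θ (X i₀) = 0 := by
  choose a ha using fun i j => (hlin i j).exists_eq_sum_C_mul_X
  set f : Fin (m + 1) → MvPolynomial (Fin d) k := fun i =>
    (-1) ^ (i : ℕ) * (φ.submatrix i.succAbove id).det with hf
  let B : Matrix (Fin d) (Fin m) (MvPolynomial (Fin (m + 1)) k) :=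
    Matrix.of fun l j => ∑ i, C (a i j l) * X i
  have hBker : ∀ c : Fin d → Fin m, fiberMap k f (B.submatrix id c).det = 0 := by
    intro c
    rw [AlgHom.map_det]
    refine Matrix.exists_vecMul_eq_zero_iff.1 ⟨fun l => Polynomial.C (X l), ?_, ?_⟩
    · intro h
      have := congrFun h ⟨0, hd⟩
      simp at this
    · ext1 b
      have hfX : ∀ r : k, fiberMap k f (C r) = Polynomial.C (C r) := fun r => by
        simp [fiberMap, IsScalarTower.algebraMap_apply k (MvPolynomial (Fin d) k)
          (Polynomial (MvPolynomial (Fin d) k))]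
      have key : ∑ l, Polynomial.C (X l) * fiberMap k f (∑ i, C (a i (c b) l) * X i) =
          Polynomial.C (∑ i, f i * φ i (c b)) * Polynomial.X := by
        simp only [ha, map_sum, map_mul, fiberMap_X, hfX, Finset.mul_sum, Finset.sum_mul]
        rw [Finset.sum_comm]
        refine Finset.sum_congr rfl fun i _ => Finset.sum_congr rfl fun l _ => ?_
        ring
      rw [Matrix.signed_minors_vecMul φ (c b), map_zero, zero_mul] at key
      simpa [Matrix.vecMul, dotProduct, B] using! key
  obtain ⟨x, hx0, hx⟩ := Matrix.exists_vecMul_eq_zero_of_minors_eq_zero (B.map θ) fun c => by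
    have := hker _ (hBker c)
    rwa [AlgHom.map_det] at this
  by_contra hi₀
  refine hx0 (eq_zero_of_vanish_on_line _ hht x fun g hg => ?_)
  set ev : MvPolynomial (Fin d) k →ₐ[k] Polynomial κ :=
    aeval (fun l => Polynomial.C (x l) * Polynomial.X) with hev
  suffices h : minorsIdeal (m + 1 - d) Φ₂ ≤ RingHom.ker ev from h hg
  refine Ideal.span_le.2 ?_
  rintro _ ⟨r, c, hr, -, rfl⟩
  have hrs : Function.Surjective r := Finite.surjective_of_injective hr
  change ev _ = 0
  rw [AlgHom.map_det]
  let e : Fin (m + 1 - d) → Fin (m + 1) := fun b => ⟨d + r b, by have := (r b).isLt; omega⟩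
  have he : Function.Injective e := fun b b' h => hr (Fin.ext (by simpa [e] using h))
  have herange : ∀ i, i ∉ Set.range e → θ (X i) = 0 := by
    intro i hi
    refine hzero i (not_le.1 fun hdi => hi ?_)
    obtain ⟨b, hb⟩ := hrs ⟨i - d, by omega⟩
    exact ⟨b, Fin.ext (by simp only [e, hb]; omega)⟩
  refine Matrix.exists_vecMul_eq_zero_iff.1 ⟨fun b => Polynomial.C (θ (X (e b))), ?_, ?_⟩
  · intro h
    obtain ⟨b, rfl⟩ : i₀ ∈ Set.range e := by
      by_contra hi
      exact hi₀ (herange _ hi)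
    exact hi₀ (by simpa using congrFun h b)
  · ext1 b
    have h1 : ∑ b', Polynomial.C (θ (X (e b'))) * ev (φ (e b') (c b)) =
        ∑ i, Polynomial.C (θ (X i)) * ev (φ i (c b)) :=
      Fintype.sum_of_injective e he _ _ (fun i hi => by simp [herange i hi]) fun _ => rfl
    have h2 : ∑ i, Polynomial.C (θ (X i)) * ev (φ i (c b)) =
        Polynomial.C (∑ l, x l * θ (∑ i, C (a i (c b) l) * X i)) * Polynomial.X := by
      have hevC : ∀ r : k, ev (C r) = Polynomial.C (θ (C r)) := fun r => by
        rw [← MvPolynomial.algebraMap_eq, ← MvPolynomial.algebraMap_eq, AlgHom.commutes,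
          AlgHom.commutes, IsScalarTower.algebraMap_apply k κ (Polynomial κ),
          Polynomial.algebraMap_eq]
      have hevX : ∀ l, ev (X l) = Polynomial.C (x l) * Polynomial.X := fun l => by simp [hev]
      simp only [ha, map_sum, map_mul, hevC, hevX, Finset.mul_sum, Finset.sum_mul]
      rw [Finset.sum_comm]
      refine Finset.sum_congr rfl fun i _ => Finset.sum_congr rfl fun l _ => ?_
      ring
    have h3 : ∑ l, x l * θ (∑ i, C (a i (c b) l) * X i) = 0 := by
      simpa [Matrix.vecMul, dotProduct, B] using! congrFun hx (c b)
    rw [h3, map_zero, zero_mul] at h2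
    have h4 : ∀ b', Φ₂ (r b') = φ (e b') := fun b' => hΦ₂ _ _ rfl
    simpa [Matrix.vecMul, dotProduct, h4] using! h1.trans h2

/-- Let `R = k[x_1,…,x_d]` and let `φ = [Φ₁; Φ₂]` be an `n×(n−1)` matrix of
linear forms with `a = d`, where `Φ₂` is a nonzero `(n−d)×(n−1)` block, `I = I_{n−1}(φ)` has
height 2, `J ⊆ I` is the ideal generated by the `d` maximal minors of `φ` fixing the rows of
`Φ₂`, and `ht I_{n−d}(Φ₂) = d`.  Then `J` is a reduction of `I`:
there is `N ≥ 0` with `I^{N+1} = J·I^N`.  (Here `n = m + 1`.) -/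
theorem statement1 {k : Type*} [Field k] [Infinite k] {d m : ℕ}
    (hd : 1 ≤ d) (hdm : d ≤ m)
    (φ : Matrix (Fin (m + 1)) (Fin m) (MvPolynomial (Fin d) k))
    (hlin : ∀ i j, (φ i j).IsHomogeneous 1)
    (Φ₂ : Matrix (Fin (m + 1 - d)) (Fin m) (MvPolynomial (Fin d) k))
    (hΦ₂ : Φ₂ = φ.submatrix (fun i : Fin (m + 1 - d) =>
      (⟨d + (i : ℕ), by have := i.isLt; omega⟩ : Fin (m + 1))) id)
    (hne : Φ₂ ≠ 0)
    (hI : idealHeight (minorsIdeal m φ) = 2)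
    (hht : idealHeight (minorsIdeal (m + 1 - d) Φ₂) = (d : ℕ∞))
    (J : Ideal (MvPolynomial (Fin d) k))
    (hJ : J = Ideal.span (Set.range fun i : Fin d =>
      (-1) ^ (i : ℕ) *
        (φ.submatrix (Fin.succAbove (⟨(i : ℕ), by have := i.isLt; omega⟩ : Fin (m + 1))) id).det)) :
    ∃ N : ℕ, (minorsIdeal m φ) ^ (N + 1) = J * (minorsIdeal m φ) ^ N := by
  rw [minorsIdeal_eq_span_signed_minors, hJ]
  refine exists_pow_succ_eq_mul_pow (k := k) (fun i : Fin (m + 1) =>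
    (-1) ^ (i : ℕ) * (φ.submatrix i.succAbove id).det)
    (fun i : Fin d => (⟨(i : ℕ), by have := i.isLt; omega⟩ : Fin (m + 1))) fun i => ?_
  rw [Ideal.radical_eq_sInf, Ideal.mem_sInf]
  rintro P ⟨hLP, hP⟩
  let θ : MvPolynomial (Fin (m + 1)) k →ₐ[k] FractionRing (MvPolynomial (Fin (m + 1)) k ⧸ P) :=
    (IsScalarTower.toAlgHom k (MvPolynomial (Fin (m + 1)) k ⧸ P) _).comp (Ideal.Quotient.mkₐ k P)
  have hθ : ∀ g, θ g = 0 ↔ g ∈ P := fun g => by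
    simp [θ, Ideal.Quotient.eq_zero_iff_mem]
  rw [← hθ]
  refine fiber_point_eq_zero hd hdm φ hlin Φ₂ ?_ hht.ge θ ?_ ?_ i
  · intro i i' hi
    rw [hΦ₂]
    funext j
    simp only [Matrix.submatrix_apply, id]
    congr 1
    exact Fin.ext hi.symm
  · exact fun g hg => (hθ g).2 (hLP (Ideal.mem_sup_left hg))
  · exact fun i hi => (hθ _).2 (hLP (Ideal.mem_sup_right (Ideal.subset_span ⟨⟨i, hi⟩, rfl⟩)))
end
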